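/- Every shrewd cardinal is Σ₂-reflecting: if κ is shrewd, then κ is inaccessible and V_κ is a Σ₂-elementary submodel of V. -/

import Mathlib

universe u

open Cardinal

/-- Formulas of the language of set theory with an additional unary predicate
symbol `pred`; variables are indexed by natural numbers. -/
inductive SF : Type
  | mem : ℕ → ℕ → SF
  | eq : ℕ → ℕ → SF
  | pred : ℕ → SF
  | not : SF → SF
  | and : SF → SF → SF
  | ex : ℕ → SF → SF

/-- The free variables of a formula. -/
def SF.fv : SF → Set ℕ
  | .mem i j => {i, j}
  | .eq i j => {i, j}
  | .pred i => {i}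
  | .not φ => φ.fv
  | .and φ ψ => φ.fv ∪ ψ.fv
  | .ex k φ => φ.fv \ {k}

/-- Tarskian satisfaction of a formula in the structure whose carrier is the
class `S`, where the membership symbol is interpreted by the binary relation `E`
and the extra unary predicate symbol by the class `P`, under the valuation `v`. -/
def Sat (P : Set ZFSet.{u}) (E : ZFSet.{u} → ZFSet.{u} → Prop) (S : Set ZFSet.{u}) :
    SF → (ℕ → ZFSet.{u}) → Prop
  | .mem i j, v => E (v i) (v j)
  | .eq i j, v => v i = v j
  | .pred i, v => v i ∈ P
  | .not φ, v => ¬ Sat P E S φ v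
  | .and φ ψ, v => Sat P E S φ v ∧ Sat P E S ψ v
  | .ex k φ, v => ∃ x, x ∈ S ∧ Sat P E S φ (Function.update v k x)

/-- Satisfaction in the `∈`-structure with carrier `S`, the predicate symbol
being interpreted by the class `R`. -/
def SatIn (R : Set ZFSet.{u}) (S : Set ZFSet.{u}) (φ : SF) (v : ℕ → ZFSet.{u}) : Prop :=
  Sat R (· ∈ ·) S φ v

/-- Δ₀-formulas: built from atomic formulas by propositional connectives and
bounded existential quantification. -/
inductive IsDeltaZero : SF → Prop
  | mem (i j) : IsDeltaZero (.mem i j)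
  | eq (i j) : IsDeltaZero (.eq i j)
  | pred (i) : IsDeltaZero (.pred i)
  | not {φ} : IsDeltaZero φ → IsDeltaZero (.not φ)
  | and {φ ψ} : IsDeltaZero φ → IsDeltaZero ψ → IsDeltaZero (.and φ ψ)
  | bex {φ} (k j) : IsDeltaZero φ → IsDeltaZero (.ex k (.and (.mem k j) φ))

mutual
  /-- Σₙ-formulas of the Lévy hierarchy. -/
  inductive IsSigma : ℕ → SF → Prop
    | of_zero {φ} : IsDeltaZero φ → IsSigma 0 φ
    | of_pi {n φ} : IsPi n φ → IsSigma (n + 1) φ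
    | ex {n φ} (k) : IsSigma (n + 1) φ → IsSigma (n + 1) (.ex k φ)
  /-- Πₙ-formulas of the Lévy hierarchy. -/
  inductive IsPi : ℕ → SF → Prop
    | of_zero {φ} : IsDeltaZero φ → IsPi 0 φ
    | not {n φ} : IsSigma (n + 1) φ → IsPi (n + 1) (.not φ)
end

/-- The valuation sending `v₀` to `a`, `v₁` to `b` and all other variables to `∅`. -/
def val2 (a b : ZFSet.{u}) : ℕ → ZFSet.{u} := fun i => if i = 0 then a else if i = 1 then b else ∅

/-- `x` is a (von Neumann) ordinal. -/
def ZOrd (x : ZFSet.{u}) : Prop := x.IsTransitive ∧ ∀ y ∈ x, ZFSet.IsTransitive y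

/-- `κ` is a (von Neumann) cardinal. -/
def ZCard (κ : ZFSet.{u}) : Prop := ZOrd κ ∧ ∀ β ∈ κ, #β.toSet < #κ.toSet

/-- `κ` is an infinite cardinal. -/
def InfCard (κ : ZFSet.{u}) : Prop := ZCard κ ∧ ZFSet.omega ⊆ κ

/-- `κ` is an infinite regular cardinal: every cofinal subset of `κ` has
cardinality `κ`. -/
def ZRegular (κ : ZFSet.{u}) : Prop :=
  InfCard κ ∧ ∀ x : ZFSet.{u}, x ⊆ κ →
    (∀ β ∈ κ, ∃ γ ∈ x, β ∈ γ ∨ β = γ) → #x.toSet = #κ.toSet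

/-- `C` is a closed unbounded (class of) subset(s) of the ordinal `κ`. -/
def ZClub (C : Set ZFSet.{u}) (κ : ZFSet.{u}) : Prop :=
  (∀ γ ∈ C, γ ∈ κ) ∧ (∀ β ∈ κ, ∃ γ ∈ C, β ∈ γ) ∧
    (∀ β ∈ κ, (∃ γ, γ ∈ β) → (∀ γ ∈ β, ∃ δ ∈ C, γ ∈ δ ∧ δ ∈ β) → β ∈ C)

/-- `S` is stationary in `κ`: it meets every closed unbounded subset of `κ`. -/
def ZStationary (S : Set ZFSet.{u}) (κ : ZFSet.{u}) : Prop :=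
  ∀ C, ZClub C κ → ∃ γ ∈ C, γ ∈ S

/-- `H(θ)`: the class of all sets hereditarily of cardinality less than `θ`. -/
def HSet (θ : ZFSet.{u}) : Set ZFSet.{u} :=
  {x | ∃ t : ZFSet.{u}, t.IsTransitive ∧ x ⊆ t ∧ #t.toSet < #θ.toSet}

/-- `θ` is the cardinal successor `κ⁺` of `κ`. -/
def SuccCardOf (θ κ : ZFSet.{u}) : Prop :=
  ZCard θ ∧ κ ∈ θ ∧ ∀ μ, ZCard μ → κ ∈ μ → θ ⊆ μ

/-- `κ` is a weakly shrewd cardinal. -/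
def WeaklyShrewd (κ : ZFSet.{u}) : Prop :=
  InfCard κ ∧
    ∀ (φ : SF) (θ A : ZFSet.{u}), φ.fv ⊆ {0, 1} → ZCard θ → κ ∈ θ → A ⊆ κ →
      SatIn ∅ (HSet θ) φ (val2 A κ) →
      ∃ κ' θ' : ZFSet.{u}, ZCard κ' ∧ ZCard θ' ∧ κ' ∈ θ' ∧ κ' ∈ κ ∧
        SatIn ∅ (HSet θ') φ (val2 (A ∩ κ') κ')

/-- `j` is an elementary embedding of the `∈`-structure (with predicate `R`)
with carrier `X` into the one with carrier `Y`. -/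
def ElemEmbOn (R : Set ZFSet.{u}) (X Y : Set ZFSet.{u}) (j : ZFSet.{u} → ZFSet.{u}) : Prop :=
  (∀ x ∈ X, j x ∈ Y) ∧
    ∀ (φ : SF) (v : ℕ → ZFSet.{u}), (∀ i, v i ∈ X) →
      (SatIn R X φ v ↔ SatIn R Y φ (fun i => j (v i)))

/-- `X` is an elementary submodel of `Y` (as `∈`-structures with predicate `R`). -/
def ElemSub (R : Set ZFSet.{u}) (X Y : Set ZFSet.{u}) : Prop :=
  X ⊆ Y ∧ ∀ (φ : SF) (v : ℕ → ZFSet.{u}), (∀ i, v i ∈ X) → (SatIn R X φ v ↔ SatIn R Y φ v)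

/-- `X` is a Σₙ-elementary submodel of `Y`. -/
def SigmaElemSub (R : Set ZFSet.{u}) (n : ℕ) (X Y : Set ZFSet.{u}) : Prop :=
  X ⊆ Y ∧ ∀ (φ : SF), IsSigma n φ → ∀ (v : ℕ → ZFSet.{u}), (∀ i, v i ∈ X) →
    (SatIn R X φ v ↔ SatIn R Y φ v)

/-- The stages of the von Neumann hierarchy, as classes:
`Vclass o` consists of all sets of rank less than `o`. -/
def Vclass (o : Ordinal.{u}) : Set ZFSet.{u} := {x | ZFSet.rank x < o}

/-- The intersection `A ∩ V_c` (for `c` an ordinal). -/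
def Vres (A c : ZFSet.{u}) : ZFSet.{u} :=
  ZFSet.sep (fun y => ZFSet.rank y < ZFSet.rank c) A

/-- `κ` is a shrewd cardinal (Rathjen): for every formula `Φ(v₀,v₁)`, every
ordinal `α` and every `A ⊆ V_κ` such that `Φ(A,κ)` holds in `V_{κ+α}`, there
are ordinals `κ̄, ᾱ < κ` such that `Φ(A ∩ V_κ̄, κ̄)` holds in `V_{κ̄+ᾱ}`. -/
def Shrewd (κ : ZFSet.{u}) : Prop :=
  ZCard κ ∧
    ∀ (φ : SF) (α A : ZFSet.{u}), φ.fv ⊆ {0, 1} → ZOrd α →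
      (∀ y ∈ A, ZFSet.rank y < ZFSet.rank κ) →
      SatIn ∅ (Vclass (ZFSet.rank κ + ZFSet.rank α)) φ (val2 A κ) →
      ∃ κ' α' : ZFSet.{u}, κ' ∈ κ ∧ α' ∈ κ ∧
        SatIn ∅ (Vclass (ZFSet.rank κ' + ZFSet.rank α')) φ (val2 (Vres A κ') κ')



theorem sat_congr (P : Set ZFSet.{u}) (E : ZFSet.{u} → ZFSet.{u} → Prop) (S : Set ZFSet.{u}) :
    ∀ (φ : SF) (v w : ℕ → ZFSet.{u}), (∀ i ∈ φ.fv, v i = w i) →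
      (Sat P E S φ v ↔ Sat P E S φ w) := by
  intro φ
  induction φ with
  | mem i j => intro v w h; simp [Sat, h i (by simp [SF.fv]), h j (by simp [SF.fv])]
  | eq i j => intro v w h; simp [Sat, h i (by simp [SF.fv]), h j (by simp [SF.fv])]
  | pred i => intro v w h; simp [Sat, h i (by simp [SF.fv])]
  | not φ ih => intro v w h; simp only [Sat]; rw [ih v w h]
  | and φ ψ ih1 ih2 =>
    intro v w h
    simp only [Sat]
    rw [ih1 v w (fun i hi => h i (Or.inl hi)), ih2 v w (fun i hi => h i (Or.inr hi))]
  | ex k φ ih =>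
    intro v w h
    simp only [Sat]
    refine exists_congr fun x => and_congr_right fun _ => ih _ _ fun i hi => ?_
    by_cases hk : i = k
    · subst hk; simp
    · simp only [Function.update_of_ne hk]
      exact h i ⟨hi, hk⟩

theorem fv_bdd (φ : SF) : ∃ n, ∀ i ∈ φ.fv, i < n := by
  induction φ with
  | mem i j => exact ⟨i + j + 1, by rintro x (rfl | rfl) <;> omega⟩
  | eq i j => exact ⟨i + j + 1, by rintro x (rfl | rfl) <;> omega⟩
  | pred i => exact ⟨i + 1, by rintro x rfl; omega⟩
  | not φ ih => exact ih
  | and φ ψ ih1 ih2 =>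
    obtain ⟨n, hn⟩ := ih1
    obtain ⟨m, hm⟩ := ih2
    refine ⟨n + m, ?_⟩
    rintro x (h | h)
    · have := hn x h; omega
    · have := hm x h; omega
  | ex k φ ih =>
    obtain ⟨n, hn⟩ := ih
    exact ⟨n, fun i hi => hn i hi.1⟩

/-- A class closed under elements. -/
def TransC (S : Set ZFSet.{u}) : Prop := ∀ x ∈ S, ∀ y ∈ x, y ∈ S

theorem transC_Vclass (o : Ordinal.{u}) : TransC (Vclass o) :=
  fun _ hx _ hy => (ZFSet.rank_lt_of_mem hy).trans hx

theorem upd_mem {S : Set ZFSet.{u}} {v : ℕ → ZFSet.{u}} (hv : ∀ i, v i ∈ S) {x : ZFSet.{u}}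
    (hx : x ∈ S) (k : ℕ) : ∀ i, Function.update v k x i ∈ S := by
  intro i
  by_cases h : i = k
  · subst h; simpa using hx
  · simpa [Function.update_of_ne h] using hv i

theorem delta0_abs {P S T : Set ZFSet.{u}} (hST : S ⊆ T) (hS : TransC S) {φ : SF}
    (h : IsDeltaZero φ) : ∀ v : ℕ → ZFSet.{u}, (∀ i, v i ∈ S) →
      (SatIn P S φ v ↔ SatIn P T φ v) := by
  induction h with
  | mem i j => intro v hv; rfl
  | eq i j => intro v hv; rfl
  | pred i => intro v hv; rfl
  | not _ ih => intro v hv; simp only [SatIn, Sat] at *; rw [ih v hv]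
  | and _ _ ih1 ih2 => intro v hv; simp only [SatIn, Sat] at *; rw [ih1 v hv, ih2 v hv]
  | bex k j _ ih =>
    intro v hv
    simp only [SatIn, Sat] at *
    constructor
    · rintro ⟨x, hx, h1, h2⟩
      exact ⟨x, hST hx, h1, (ih _ (upd_mem hv hx k)).1 h2⟩
    · rintro ⟨x, hx, h1, h2⟩
      have hxS : x ∈ S := by
        by_cases hjk : j = k
        · subst hjk
          simp only [Function.update_self] at h1
          exact absurd h1 (ZFSet.mem_irrefl x)
        · rw [Function.update_self, Function.update_of_ne hjk] at h1
          exact hS _ (hv j) _ h1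
      exact ⟨x, hxS, h1, (ih _ (upd_mem hv hxS k)).2 h2⟩

theorem sigma1_rec {C : SF → Prop} (h0 : ∀ φ, IsDeltaZero φ → C φ)
    (hex : ∀ k φ, IsSigma 1 φ → C φ → C (.ex k φ)) : ∀ φ, IsSigma 1 φ → C φ := by
  intro φ
  induction φ with
  | ex k φ ih =>
    intro h
    cases h with
    | of_pi h => cases h with
      | of_zero h => exact h0 _ h
    | ex _ h => exact hex _ _ h (ih h)
  | _ =>
    intro h
    cases h with
    | of_pi h => cases h with
      | of_zero h => exact h0 _ h

theorem sigma2_rec {C : SF → Prop} (h0 : ∀ φ, IsSigma 1 φ → C (.not φ))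
    (hex : ∀ k φ, IsSigma 2 φ → C φ → C (.ex k φ)) : ∀ φ, IsSigma 2 φ → C φ := by
  intro φ
  induction φ with
  | ex k φ ih =>
    intro h
    cases h with
    | of_pi h => cases h
    | ex _ h => exact hex _ _ h (ih h)
  | not φ ih =>
    intro h
    cases h with
    | of_pi h => cases h with
      | not h => exact h0 _ h
  | _ =>
    intro h
    cases h with
    | of_pi h => cases h

theorem sigma1_up {P S T : Set ZFSet.{u}} (hST : S ⊆ T) (hS : TransC S) {φ : SF}
    (h : IsSigma 1 φ) : ∀ v : ℕ → ZFSet.{u}, (∀ i, v i ∈ S) →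
      SatIn P S φ v → SatIn P T φ v := by
  refine sigma1_rec (C := fun φ => ∀ v : ℕ → ZFSet.{u}, (∀ i, v i ∈ S) →
      SatIn P S φ v → SatIn P T φ v) ?_ ?_ φ h
  · intro φ h v hv
    exact (delta0_abs hST hS h v hv).1
  · rintro k φ _ ih v hv ⟨x, hx, hs⟩
    exact ⟨x, hST hx, ih _ (upd_mem hv hx k) hs⟩

/-- If `S` is Σ₁-correct in `T`, then Σ₂-formulas go up from `S` to `T`. -/
theorem sigma2_up {P S T : Set ZFSet.{u}} (hST : S ⊆ T)
    (hdown : ∀ φ, IsSigma 1 φ → ∀ v : ℕ → ZFSet.{u}, (∀ i, v i ∈ S) →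
      SatIn P T φ v → SatIn P S φ v) {φ : SF}
    (h : IsSigma 2 φ) : ∀ v : ℕ → ZFSet.{u}, (∀ i, v i ∈ S) →
      SatIn P S φ v → SatIn P T φ v := by
  refine sigma2_rec (C := fun φ => ∀ v : ℕ → ZFSet.{u}, (∀ i, v i ∈ S) →
      SatIn P S φ v → SatIn P T φ v) ?_ ?_ φ h
  · intro φ h v hv hs ht
    exact hs (hdown φ h v hv ht)
  · rintro k φ _ ih v hv ⟨x, hx, hs⟩
    exact ⟨x, hST hx, ih _ (upd_mem hv hx k) hs⟩

/-- A Σ₂-formula that holds in `V` holds in `Vclass o` for all sufficiently large `o`. -/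
theorem sigma2_down {P : Set ZFSet.{u}} {φ : SF}
    (h : IsSigma 2 φ) : ∀ v : ℕ → ZFSet.{u}, SatIn P Set.univ φ v →
      ∃ r : Ordinal.{u}, ∀ o, r ≤ o → (∀ i, v i ∈ Vclass o) → SatIn P (Vclass o) φ v := by
  refine sigma2_rec (C := fun φ => ∀ v : ℕ → ZFSet.{u}, SatIn P Set.univ φ v →
      ∃ r : Ordinal.{u}, ∀ o, r ≤ o → (∀ i, v i ∈ Vclass o) → SatIn P (Vclass o) φ v) ?_ ?_ φ h
  · intro φ h v hv
    refine ⟨0, fun o _ ho hs => hv (sigma1_up (Set.subset_univ _) (transC_Vclass o) h v ho hs)⟩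
  · rintro k φ _ ih v ⟨x, hx, hs⟩
    obtain ⟨r, hr⟩ := ih _ hs
    refine ⟨max r (Order.succ (ZFSet.rank x)), fun o ho hv => ?_⟩
    have hxo : x ∈ Vclass o := Order.succ_le_iff.1 ((le_max_right _ _).trans ho)
    exact ⟨x, hxo, hr o ((le_max_left _ _).trans ho) (upd_mem hv hxo k)⟩

/-! ### Skolem hulls, the Mostowski collapse and Σ₁-correctness -/

/-- A numerical code of a formula. -/
def SF.code : SF → ℕ
  | .mem i j => Nat.pair 0 (Nat.pair i j)
  | .eq i j => Nat.pair 1 (Nat.pair i j)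
  | .pred i => Nat.pair 2 i
  | .not φ => Nat.pair 3 φ.code
  | .and φ ψ => Nat.pair 4 (Nat.pair φ.code ψ.code)
  | .ex k φ => Nat.pair 5 (Nat.pair k φ.code)

theorem SF.code_injective : Function.Injective SF.code := by
  intro φ
  induction φ with
  | mem i j => intro ψ h; cases ψ <;> simp_all [SF.code]
  | eq i j => intro ψ h; cases ψ <;> simp_all [SF.code]
  | pred i => intro ψ h; cases ψ <;> simp_all [SF.code]
  | not φ ih => 
    intro ψ h
    cases ψ <;> simp [SF.code] at h
    rw [ih h]
  | and φ ψ ih1 ih2 =>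
    intro χ h
    cases χ <;> simp [SF.code] at h
    rw [ih1 h.1, ih2 h.2]
  | ex k φ ih =>
    intro ψ h
    cases ψ <;> simp [SF.code] at h
    rw [h.1, ih h.2]

theorem SF.countable : Countable SF := SF.code_injective.countable

open Classical in
/-- A Skolem function for `V`. -/
noncomputable def sk (k : ℕ) (φ : SF) (v : ℕ → ZFSet.{u}) : ZFSet.{u} :=
  if h : ∃ x, SatIn ∅ Set.univ φ (Function.update v k x) then h.choose else ∅

/-- Arities of the Skolem terms. -/
def skAr (T : Set ZFSet.{u}) : T ⊕ (SF × ℕ × ℕ) → Type :=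
  Sum.elim (fun _ => Empty) (fun p => Fin p.2.2)

/-- Evaluation of a Skolem term. -/
noncomputable def skStep (T : Set ZFSet.{u}) :
    (Σ a : T ⊕ (SF × ℕ × ℕ), skAr T a → ZFSet.{u}) → ZFSet.{u}
  | ⟨.inl a, _⟩ => a.1
  | ⟨.inr (φ, k, n), f⟩ =>
      sk k φ (fun i => if h : i < n then f (⟨i, h⟩ : Fin n) else ∅)

/-- The Skolem hull of `T` in `V`. -/
noncomputable def hull (T : Set ZFSet.{u}) : Set ZFSet.{u} :=
  Set.range (WType.elim (β := skAr T) ZFSet.{u} (skStep T))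

theorem mk_hull_le (T : Set ZFSet.{u}) : #(hull T) ≤ max #T ℵ₀ := by
  have : ∀ a, Finite (skAr T a) := by
    rintro (a | a)
    · exact inferInstanceAs (Finite Empty)
    · exact inferInstanceAs (Finite (Fin _))
  have := SF.countable
  refine (Cardinal.mk_range_le).trans ?_
  refine (WType.cardinalMk_le_max_aleph0_of_finite'.{u+1, 0}).trans ?_
  refine max_le ?_ (le_max_right _ _)
  simp only [mk_sum, Cardinal.lift_id'.{0, u+1}]
  refine (Cardinal.add_le_max _ _).trans (max_le (max_le (le_max_left _ _) ?_) (le_max_right _ _))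
  refine le_trans ?_ (le_max_right _ _)
  rw [Cardinal.lift_le_aleph0]
  exact mk_le_aleph0

theorem subset_hull (T : Set ZFSet.{u}) : T ⊆ hull T := by
  intro x hx
  exact ⟨WType.mk (.inl ⟨x, hx⟩) (fun e => nomatch (show Empty from e)), rfl⟩

theorem hull_elem (T : Set ZFSet.{u}) : ∀ (φ : SF) (v : ℕ → ZFSet.{u}), (∀ i, v i ∈ hull T) →
    (SatIn ∅ (hull T) φ v ↔ SatIn ∅ Set.univ φ v) := by
  intro φ
  induction φ with
  | mem i j => intro v hv; rfl
  | eq i j => intro v hv; rfl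
  | pred i => intro v hv; rfl
  | not φ ih => intro v hv; simp only [SatIn, Sat] at *; rw [ih v hv]
  | and φ ψ ih1 ih2 => intro v hv; simp only [SatIn, Sat] at *; rw [ih1 v hv, ih2 v hv]
  | ex k φ ih =>
    intro v hv
    constructor
    · rintro ⟨x, hx, hs⟩
      exact ⟨x, trivial, (ih _ (upd_mem hv hx k)).1 hs⟩
    · rintro ⟨x, -, hs⟩
      obtain ⟨n, hn⟩ := fv_bdd φ
      have hv0 := hv
      choose w hw using hv
      have hcong : ∀ y, SatIn ∅ Set.univ φ (Function.update (fun i => if i < n then v i else ∅) k y) ↔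
          SatIn ∅ Set.univ φ (Function.update v k y) := by
        intro y
        refine sat_congr _ _ _ _ _ _ fun i hi => ?_
        by_cases hk : i = k
        · subst hk; simp
        · simp [Function.update_of_ne hk, hn i hi]
      have hterm : sk k φ (fun i => if i < n then v i else ∅) ∈ hull T := by
        refine ⟨WType.mk (.inr (φ, k, n)) (fun i : Fin n => w i), ?_⟩
        show sk k φ _ = _
        congr 1
        funext i
        by_cases hi : i < n
        · simp only [hi, dif_pos, if_pos]; exact hw i
        · simp [hi]
      have hex : ∃ x, SatIn ∅ Set.univ φ (Function.update (fun i => if i < n then v i else ∅) k x) :=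
        ⟨x, (hcong x).2 hs⟩
      refine ⟨_, hterm, (ih _ (upd_mem hv0 hterm k)).2 ?_⟩
      rw [← hcong]
      unfold sk
      rw [dif_pos hex]
      exact hex.choose_spec

theorem hull_ext (T : Set ZFSet.{u}) {x y : ZFSet.{u}} (hx : x ∈ hull T) (hy : y ∈ hull T)
    (h : ∀ z ∈ hull T, z ∈ x ↔ z ∈ y) : x = y := by
  have key : ∀ x ∈ hull T, ∀ y ∈ hull T, (∀ z ∈ hull T, z ∈ x → z ∈ y) → x ⊆ y := by
    intro x hx y hy h z hz
    by_contra hzy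
    let v : ℕ → ZFSet.{u} := fun i => if i = 0 then x else y
    have hv : ∀ i, v i ∈ hull T := by
      intro i; by_cases hi : i = 0 <;> simp [v, hi, hx, hy]
    have := (hull_elem T (.ex 2 (.and (.mem 2 0) (.not (.mem 2 1)))) v hv).2
      ⟨z, trivial, by simp [Sat, v, hz, hzy]⟩
    obtain ⟨w, hw, hs⟩ := this
    simp [Sat, v] at hs
    exact hs.2 (h w hw hs.1)
  apply ZFSet.ext
  intro z
  exact ⟨fun hz => key x hx y hy (fun z hz => (h z hz).1) hz,
    fun hz => key y hy x hx (fun z hz => (h z hz).2) hz⟩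

instance small_mem_and (x : ZFSet.{u}) (M : Set ZFSet.{u}) :
    Small.{u} {y : ZFSet.{u} // y ∈ x ∧ y ∈ M} :=
  small_of_injective (β := x) (f := fun y => ⟨y.1, y.2.1⟩)
    (fun _ _ h => Subtype.ext (congrArg (fun z => z.1) h))

/-- The Mostowski collapse of the class `M`. -/
noncomputable def coll (M : Set ZFSet.{u}) (x : ZFSet.{u}) : ZFSet.{u} :=
  ZFSet.range (fun y : {y : ZFSet.{u} // y ∈ x ∧ y ∈ M} => coll M y.1)
termination_by x
decreasing_by exact y.2.1

theorem mem_coll {M : Set ZFSet.{u}} {x z : ZFSet.{u}} :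
    z ∈ coll M x ↔ ∃ y, y ∈ x ∧ y ∈ M ∧ coll M y = z := by
  rw [coll]
  simp [and_assoc]

theorem coll_inj {T : Set ZFSet.{u}} : ∀ x ∈ hull T, ∀ y ∈ hull T,
    coll (hull T) x = coll (hull T) y → x = y := by
  intro x
  induction x using ZFSet.inductionOn with
  | h x ih =>
    intro hx y hy h
    apply hull_ext T hx hy
    intro z hz
    constructor
    · intro hzx
      have : coll (hull T) z ∈ coll (hull T) y := h ▸ mem_coll.2 ⟨z, hzx, hz, rfl⟩
      obtain ⟨w, hwy, hw, hwz⟩ := mem_coll.1 this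
      rw [ih z hzx hz w hw hwz.symm]
      exact hwy
    · intro hzy
      have : coll (hull T) z ∈ coll (hull T) x := h ▸ mem_coll.2 ⟨z, hzy, hz, rfl⟩
      obtain ⟨w, hwx, hw, hwz⟩ := mem_coll.1 this
      rw [← ih w hwx hw z hz hwz]
      exact hwx

theorem coll_mem {T : Set ZFSet.{u}} {x y : ZFSet.{u}} (hx : x ∈ hull T) (_hy : y ∈ hull T) :
    coll (hull T) x ∈ coll (hull T) y ↔ x ∈ y := by
  constructor
  · intro h
    obtain ⟨w, hwy, hw, hwz⟩ := mem_coll.1 h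
    rw [← coll_inj w hw x hx hwz]
    exact hwy
  · intro h
    exact mem_coll.2 ⟨x, h, hx, rfl⟩

theorem coll_fix {T : Set ZFSet.{u}} (hT : TransC T) : ∀ x ∈ T, coll (hull T) x = x := by
  intro x
  induction x using ZFSet.inductionOn with
  | h x ih =>
    intro hx
    apply ZFSet.ext
    intro z
    rw [mem_coll]
    constructor
    · rintro ⟨y, hyx, -, rfl⟩
      rw [ih y hyx (hT x hx y hyx)]
      exact hyx
    · intro hz
      exact ⟨z, hz, subset_hull T (hT x hx z hz), ih z hz (hT x hx z hz)⟩

theorem coll_sat (T : Set ZFSet.{u}) : ∀ (φ : SF) (v : ℕ → ZFSet.{u}), (∀ i, v i ∈ hull T) →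
    (SatIn ∅ (hull T) φ v ↔ SatIn ∅ (coll (hull T) '' hull T) φ (fun i => coll (hull T) (v i))) := by
  intro φ
  induction φ with
  | mem i j => intro v hv; exact (coll_mem (hv i) (hv j)).symm
  | eq i j =>
    intro v hv
    exact ⟨fun h => congrArg _ h, fun h => coll_inj _ (hv i) _ (hv j) h⟩
  | pred i => intro v hv; exact Iff.rfl
  | not φ ih => intro v hv; simp only [SatIn, Sat] at *; rw [ih v hv]
  | and φ ψ ih1 ih2 => intro v hv; simp only [SatIn, Sat] at *; rw [ih1 v hv, ih2 v hv]
  | ex k φ ih =>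
    intro v hv
    have hup : ∀ x, (fun i => coll (hull T) (Function.update v k x i)) =
        Function.update (fun i => coll (hull T) (v i)) k (coll (hull T) x) := by
      intro x
      funext i
      by_cases hk : i = k
      · subst hk; simp
      · simp [Function.update_of_ne hk]
    constructor
    · rintro ⟨x, hx, hs⟩
      refine ⟨_, ⟨x, hx, rfl⟩, ?_⟩
      have := (ih _ (upd_mem hv hx k)).1 hs
      rwa [hup] at this
    · rintro ⟨_, ⟨x, hx, rfl⟩, hs⟩
      refine ⟨x, hx, (ih _ (upd_mem hv hx k)).2 ?_⟩
      rw [hup]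
      exact hs

theorem zord_iff {x : ZFSet.{u}} : ZOrd x ↔ x.IsOrdinal := by
  rw [ZFSet.isOrdinal_iff_forall_mem_isTransitive]
  rfl

theorem rank_attained {N : Set ZFSet.{u}} (hN : TransC N) : ∀ x ∈ N, ∀ r ≤ ZFSet.rank x,
    ∃ y ∈ N, ZFSet.rank y = r := by
  intro x
  induction x using ZFSet.inductionOn with
  | h x ih =>
    intro hx r hr
    rcases hr.eq_or_lt with h | h
    · exact ⟨x, hx, h.symm⟩
    · obtain ⟨y, hy, hry⟩ := ZFSet.lt_rank_iff.1 h
      exact ih y hy (hN x hx y hy) r hry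

/-- The closure property of `l` that ensures `V_l` is Σ₁-correct. -/
def GoodH (l : Ordinal.{u}) : Prop :=
  Order.IsSuccLimit l ∧ Ordinal.omega0 < l ∧
    ∀ x ∈ Vclass l, ∃ o ∈ Vclass l, ZOrd o ∧ #x.toSet < #o.toSet

theorem hull_coll_sub {l : Ordinal.{u}} (hl : GoodH l) {r : Ordinal.{u}} (hr : r < l) 
    (hw : Ordinal.omega0 ≤ r) :
    coll (hull (Vclass r)) '' hull (Vclass r) ⊆ Vclass l := by
  have hcoe : Vclass r = (ZFSet.vonNeumann r).toSet := by
    ext x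
    exact (ZFSet.mem_vonNeumann (x := x) (o := r)).symm
  set N := coll (hull (Vclass r)) '' hull (Vclass r) with hNdef
  have hN : TransC N := by
    rintro _ ⟨x, hx, rfl⟩ y hy
    obtain ⟨w, hwx, hw, rfl⟩ := mem_coll.1 hy
    exact ⟨w, hw, rfl⟩
  have hcard : #N ≤ #(Vclass r) := by
    refine mk_image_le.trans ((mk_hull_le _).trans (max_le le_rfl ?_))
    have hinj : Function.Injective (fun n : ℕ => (⟨(n : Ordinal.{u}).toZFSet, by
        show ZFSet.rank _ < r
        rw [Ordinal.rank_toZFSet]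
        exact (Ordinal.natCast_lt_omega0 n).trans_le hw⟩ : Vclass r)) := by
      intro a b hab
      have := Ordinal.toZFSet_injective (congrArg Subtype.val hab)
      exact_mod_cast this
    have := mk_le_of_injective (α := ULift.{u+1} ℕ) (hinj.comp ULift.down_injective)
    simpa using this
  intro z hz
  by_contra hlt
  have hle : l ≤ ZFSet.rank z := not_lt.1 hlt
  obtain ⟨o, hol, ho, hlt⟩ := hl.2.2 (ZFSet.vonNeumann r) (by
    show ZFSet.rank _ < l
    simpa using hr)
  rw [← hcoe] at hlt
  refine absurd (hlt.trans_le ?_) (lt_irrefl _)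
  refine le_trans ?_ hcard
  have hch : ∀ b : o.toSet, ∃ y : N, ZFSet.rank y.1 = ZFSet.rank b.1 := by
    intro b
    have hb : b.1 ∈ o := b.2
    obtain ⟨y, hy, h⟩ := rank_attained hN z hz (ZFSet.rank b.1)
      (((ZFSet.rank_lt_of_mem hb).trans hol).le.trans hle)
    exact ⟨⟨y, hy⟩, h⟩
  choose g hg using hch
  refine mk_le_of_injective (f := g) ?_
  intro a b hab
  have ha : a.1 ∈ o := a.2
  have hb : b.1 ∈ o := b.2
  have hoo := zord_iff.1 ho
  apply Subtype.ext
  rw [← (hoo.mem ha).rank_inj (hoo.mem hb), ← hg a, ← hg b, hab]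

theorem sigma1_correct {l : Ordinal.{u}} (hl : GoodH l) {φ : SF} (h : IsSigma 1 φ)
    (v : ℕ → ZFSet.{u}) (hv : ∀ i, v i ∈ Vclass l) (hs : SatIn ∅ Set.univ φ v) :
    SatIn ∅ (Vclass l) φ v := by
  obtain ⟨n, hn⟩ := fv_bdd φ
  have hr : ∃ r < l, Ordinal.omega0 ≤ r ∧ ∀ i < n, ZFSet.rank (v i) < r := by
    clear hn
    induction n with
    | zero => exact ⟨_, hl.2.1, le_rfl, by simp⟩
    | succ n ih =>
      obtain ⟨r, hr, hw, h⟩ := ih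
      refine ⟨max r (Order.succ (ZFSet.rank (v n))), max_lt hr (hl.1.succ_lt (hv n)),
        hw.trans (le_max_left _ _), ?_⟩
      intro i hi
      rcases Nat.lt_succ_iff_lt_or_eq.1 hi with hi | rfl
      · exact (h i hi).trans_le (le_max_left _ _)
      · exact (Order.lt_succ _).trans_le (le_max_right _ _)
  obtain ⟨r, hr, hw, hvr⟩ := hr
  let w : ℕ → ZFSet.{u} := fun i => if i < n then v i else ∅
  have hwr : ∀ i, w i ∈ Vclass r := by
    intro i
    by_cases hi : i < n
    · simp only [w, hi, if_true]; exact hvr i hi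
    · simp only [w, hi, if_false]
      show ZFSet.rank ∅ < r
      rw [ZFSet.rank_empty]
      exact Ordinal.omega0_pos.trans_le hw
  have hvw : ∀ i ∈ φ.fv, v i = w i := by
    intro i hi
    simp [w, hn i hi]
  have hsub := subset_hull (Vclass r)
  have h1 : SatIn ∅ Set.univ φ w := (sat_congr _ _ _ _ _ _ hvw).1 hs
  have h2 := (hull_elem (Vclass r) φ w (fun i => hsub (hwr i))).2 h1
  have h3 := (coll_sat (Vclass r) φ w (fun i => hsub (hwr i))).1 h2
  have hfix : (fun i => coll (hull (Vclass r)) (w i)) = w := by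
    funext i
    exact coll_fix (transC_Vclass r) _ (hwr i)
  rw [hfix] at h3
  have hN : TransC (coll (hull (Vclass r)) '' hull (Vclass r)) := by
    rintro _ ⟨x, hx, rfl⟩ y hy
    obtain ⟨w, hwx, hw, rfl⟩ := mem_coll.1 hy
    exact ⟨w, hw, rfl⟩
  have h4 := sigma1_up (hull_coll_sub hl hr hw) hN h w (fun i => by
    rw [← hfix]; exact ⟨_, hsub (hwr i), rfl⟩) h3
  exact (sat_congr _ _ _ _ _ _ hvw).2 h4

/-! ### First consequences of shrewdness -/

/-- Universal quantification. -/
def SF.all (k : ℕ) (φ : SF) : SF := .not (.ex k (.not φ))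
/-- Implication. -/
def SF.imp (φ ψ : SF) : SF := .not (.and φ (.not ψ))
/-- Disjunction. -/
def SF.or (φ ψ : SF) : SF := .not (.and (.not φ) (.not ψ))
/-- Equivalence. -/
def SF.iff (φ ψ : SF) : SF := .and (φ.imp ψ) (ψ.imp φ)

section satlemmas
variable (P S : Set ZFSet.{u}) (φ ψ : SF) (v : ℕ → ZFSet.{u}) (i j k : ℕ)

theorem sat_mem : SatIn P S (.mem i j) v ↔ v i ∈ v j := Iff.rfl
theorem sat_eq : SatIn P S (.eq i j) v ↔ v i = v j := Iff.rfl
theorem sat_not : SatIn P S (.not φ) v ↔ ¬ SatIn P S φ v := Iff.rfl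
theorem sat_and : SatIn P S (.and φ ψ) v ↔ SatIn P S φ v ∧ SatIn P S ψ v := Iff.rfl
theorem sat_ex : SatIn P S (.ex k φ) v ↔ ∃ x ∈ S, SatIn P S φ (Function.update v k x) := Iff.rfl
theorem sat_all : SatIn P S (.all k φ) v ↔ ∀ x ∈ S, SatIn P S φ (Function.update v k x) := by
  simp [SF.all, sat_not, sat_ex]
theorem sat_imp : SatIn P S (.imp φ ψ) v ↔ (SatIn P S φ v → SatIn P S ψ v) := by
  simp [SF.imp, sat_not, sat_and]
theorem sat_or : SatIn P S (.or φ ψ) v ↔ (SatIn P S φ v ∨ SatIn P S ψ v) := by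
  simp only [SF.or, sat_not, sat_and]; tauto
theorem sat_iff : SatIn P S (.iff φ ψ) v ↔ (SatIn P S φ v ↔ SatIn P S ψ v) := by
  simp only [SF.iff, sat_imp, sat_and]; tauto
end satlemmas

theorem shrewd_param {κ : ZFSet.{u}} (h : Shrewd κ) {φ : SF} (hφ : φ.fv ⊆ {1, 2})
    {α p : ZFSet.{u}} (hα : ZOrd α) (hp : ZFSet.rank p < ZFSet.rank κ) {v : ℕ → ZFSet.{u}}
    (h1 : v 1 = κ) (h2 : v 2 = p)
    (hs : SatIn ∅ (Vclass (ZFSet.rank κ + ZFSet.rank α)) φ v) :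
    ∃ κ' ∈ κ, ∃ α' ∈ κ, ZFSet.rank p < ZFSet.rank κ' ∧ ∀ w : ℕ → ZFSet.{u}, w 1 = κ' → w 2 = p →
      SatIn ∅ (Vclass (ZFSet.rank κ' + ZFSet.rank α')) φ w := by
  obtain ⟨κ', α', hκ', hα', x, hx, hs'⟩ := h.2 (.ex 2 (.and (.mem 2 0) φ)) α {p} (by
    rintro i ⟨(h | h) | h, h2⟩
    · exact absurd h h2
    · exact Or.inl h
    · rcases hφ h with h | h
      · exact Or.inr h
      · exact absurd h h2) hα (by simpa using hp) (by
    refine ⟨p, hp.trans_le le_self_add, ?_, ?_⟩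
    · simp [Sat, val2]
    · refine (sat_congr _ _ _ _ _ _ ?_).1 hs
      intro i hi
      rcases hφ hi with rfl | rfl
      · simp [h1, val2]
      · simp [h2])
  have hm : x ∈ Vres {p} κ' := by simpa [Sat, val2] using hs'.1
  simp only [Vres, ZFSet.mem_sep, ZFSet.mem_singleton] at hm
  obtain ⟨rfl, hr⟩ := hm
  refine ⟨κ', hκ', α', hα', hr, fun w hw1 hw2 => ?_⟩
  refine (sat_congr _ _ _ _ _ _ ?_).1 hs'.2
  intro i hi
  rcases hφ hi with rfl | rfl
  · simp [hw1, val2]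
  · simp [hw2]

theorem zord_empty : ZOrd (∅ : ZFSet.{u}) := zord_iff.2 ZFSet.isOrdinal_empty

theorem shrewd_unbdd {κ : ZFSet.{u}} (h : Shrewd κ) {p : ZFSet.{u}}
    (hp : ZFSet.rank p < ZFSet.rank κ) : ∃ κ' ∈ κ, ZFSet.rank p < ZFSet.rank κ' := by
  obtain ⟨κ', hκ', _, _, hr, _⟩ := shrewd_param h (φ := .eq 1 1) (by simp [SF.fv]) zord_empty hp
    (v := fun i => if i = 1 then κ else p) (by simp) (by simp) rfl
  exact ⟨κ', hκ', hr⟩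

theorem shrewd_limit {κ : ZFSet.{u}} (h : Shrewd κ) : Order.IsSuccLimit (ZFSet.rank κ) := by
  have hne : ZFSet.rank κ ≠ 0 := by
    obtain ⟨κ', α', hκ', -⟩ := h.2 (.eq 1 1) ∅ ∅ (by simp [SF.fv]) zord_empty (by simp) rfl
    exact (zero_le.trans_lt (ZFSet.rank_lt_of_mem hκ')).ne'
  refine Ordinal.isSuccLimit_iff.2 ⟨hne, Order.isSuccPrelimit_of_succ_lt ?_⟩
  intro a ha
  obtain ⟨κ', hκ', hr⟩ := shrewd_unbdd h (p := a.toZFSet) (by simpa using ha)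
  rw [Ordinal.rank_toZFSet] at hr
  exact (Order.succ_le_of_lt hr).trans_lt (ZFSet.rank_lt_of_mem hκ')

theorem zord_rank_limit {κ : ZFSet.{u}} (hne : ∃ x, x ∈ κ)
    (hl : ∀ x ∈ κ, ∃ y ∈ κ, x ∈ y) : Order.IsSuccLimit (ZFSet.rank κ) := by
  refine Ordinal.isSuccLimit_iff.2 ⟨?_, Order.isSuccPrelimit_of_succ_lt ?_⟩
  · obtain ⟨x, hx⟩ := hne
    exact (zero_le.trans_lt (ZFSet.rank_lt_of_mem hx)).ne'
  · intro a ha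
    obtain ⟨x, hx, hax⟩ := ZFSet.lt_rank_iff.1 ha
    obtain ⟨y, hy, hxy⟩ := hl x hx
    exact (Order.succ_le_of_lt (hax.trans_lt (ZFSet.rank_lt_of_mem hxy))).trans_lt
      (ZFSet.rank_lt_of_mem hy)

theorem zord_mem_iff {κ : ZFSet.{u}} (ho : ZOrd κ) {a : Ordinal.{u}} :
    a.toZFSet ∈ κ ↔ a < ZFSet.rank κ := by
  rw [← (ZFSet.isOrdinal_toZFSet a).rank_lt_iff_mem (zord_iff.1 ho), Ordinal.rank_toZFSet]

theorem shrewd_omega {κ : ZFSet.{u}} (h : Shrewd κ) : Ordinal.omega0 < ZFSet.rank κ := by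
  have hl := shrewd_limit h
  have ho := h.1.1
  have hoo := zord_iff.1 ho
  obtain ⟨κ', α', hκ', -, hs⟩ := h.2 (.and (.ex 2 (.mem 2 1))
      (.all 2 (.imp (.mem 2 1) (.ex 3 (.and (.mem 3 1) (.mem 2 3)))))) ∅ ∅ (by
      simp [SF.fv, SF.all, SF.imp]; grind) zord_empty (by simp) (by
    simp only [sat_and, sat_ex, sat_all, sat_imp, sat_mem]
    simp only [ZFSet.rank_empty, add_zero]
    constructor
    · refine ⟨∅, ?_, ?_⟩
      · show ZFSet.rank ∅ < _
        simpa using hl.bot_lt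
      · have := (zord_mem_iff ho (a := 0)).2 (by simpa using hl.bot_lt)
        simpa [val2] using this
    · intro x hx hxκ
      simp [val2] at hxκ
      obtain ⟨κ', hκ', hr⟩ := shrewd_unbdd h hx
      refine ⟨κ', ZFSet.rank_lt_of_mem hκ', ?_⟩
      simp [val2, hκ']
      exact ((hoo.mem hxκ).rank_lt_iff_mem (hoo.mem hκ')).1 hr)
  simp only [sat_and, sat_ex, sat_all, sat_imp, sat_mem] at hs
  simp [val2] at hs
  have hlim : Order.IsSuccLimit (ZFSet.rank κ') := by
    refine zord_rank_limit ?_ ?_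
    · obtain ⟨x, -, hx⟩ := hs.1
      exact ⟨x, hx⟩
    · intro x hx
      obtain ⟨y, -, hy⟩ := hs.2 x ((ZFSet.rank_lt_of_mem hx).trans_le le_self_add) hx
      exact ⟨y, hy⟩
  exact (Ordinal.omega0_le_of_isSuccLimit hlim).trans_lt (ZFSet.rank_lt_of_mem hκ')

/-- Replacement for `V_κ`. -/
theorem shrewd_repl {κ : ZFSet.{u}} (h : Shrewd κ) {d : ZFSet.{u}}
    (hd : ZFSet.rank d < ZFSet.rank κ) (f : ZFSet.{u} → ZFSet.{u}) (hf : ∀ x ∈ d, f x ∈ κ) :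
    ∃ κ' ∈ κ, ∀ x ∈ d, f x ∈ κ' := by
  have hl := shrewd_limit h
  have hoo := zord_iff.1 h.1.1
  let c : ZFSet.{u} → ZFSet.{u} := fun x => {{x}, {∅, {∅}, f x}}
  let A : ZFSet.{u} := insert {∅, d} (ZFSet.range (fun x : d => c x.1))
  have hA : ∀ y, y ∈ A ↔ y = {∅, d} ∨ ∃ x ∈ d, c x = y := by
    intro y; simp [A]
  have hpos : 0 < ZFSet.rank κ := by simpa using hl.bot_lt
  have hsucc : ∀ {a}, a < ZFSet.rank κ → Order.succ a < ZFSet.rank κ := fun h => hl.succ_lt h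
  have hAr : ∀ y ∈ A, ZFSet.rank y < ZFSet.rank κ := by
    intro y hy
    rcases (hA y).1 hy with rfl | ⟨x, hx, rfl⟩
    · simp only [ZFSet.rank_pair, ZFSet.rank_empty]
      exact max_lt (hsucc hpos) (hsucc hd)
    · simp only [c, ZFSet.rank_insert, ZFSet.rank_empty, ZFSet.rank_singleton]
      have h1 := (ZFSet.rank_lt_of_mem hx).trans hd
      have h2 := ZFSet.rank_lt_of_mem (hf x hx)
      exact max_lt (hsucc (hsucc h1)) (hsucc (max_lt (hsucc hpos) (max_lt (hsucc (hsucc hpos))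
        (hsucc h2))))
  obtain ⟨κ', α', hκ', -, hs⟩ := h.2 (.ex 2 (.and (.mem 2 0) (.and
      (.ex 3 (.and (.mem 3 2) (.all 4 (.not (.mem 4 3)))))
      (.all 3 (.imp (.mem 3 2) (.all 4 (.imp (.mem 4 3) (.ex 5 (.and (.mem 5 0)
        (.and (.all 6 (.imp (.mem 6 5) (.ex 7 (.mem 7 6)))) (.ex 6 (.and (.mem 6 5) (.and (.mem 4 6) (.all 7 (.imp (.mem 7 6) (.eq 7 4))))))))))))))))
      ∅ A (by simp [SF.fv, SF.all, SF.imp]; grind) zord_empty hAr (by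
    simp only [sat_and, sat_ex, sat_all, sat_imp, sat_mem, sat_not, sat_eq]
    simp only [ZFSet.rank_empty, add_zero]
    simp [val2]
    have hmA : {∅, d} ∈ A := (hA _).2 (Or.inl rfl)
    refine ⟨{∅, d}, hAr _ hmA, hmA, ⟨∅, by simpa [Vclass] using hpos, by simp⟩, ?_⟩
    intro d' hd' hm x hx hxd'
    have hxd : x ∈ d := by
      rcases ZFSet.mem_pair.1 hm with rfl | rfl
      · simp at hxd'
      · exact hxd'
    have hcA : c x ∈ A := (hA _).2 (Or.inr ⟨x, hxd, rfl⟩)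
    refine ⟨c x, hAr _ hcA, hcA, ?_, {x}, ?_, ?_⟩
    · intro t _ ht
      simp only [c, ZFSet.mem_pair] at ht
      rcases ht with rfl | rfl
      · exact ⟨x, hx, by simp⟩
      · exact ⟨∅, by simpa [Vclass] using hpos, by simp⟩
    · exact transC_Vclass _ (c x) (hAr _ hcA) _ (by simp [c])
    · simp [c])
  simp only [sat_and, sat_ex, sat_all, sat_imp, sat_mem, sat_not, sat_eq] at hs
  simp [val2] at hs
  obtain ⟨m, hmS, hm, ⟨e, heS, hem, he⟩, hall⟩ := hs
  set S := Vclass (ZFSet.rank κ' + ZFSet.rank α') with hS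
  have htr : TransC S := transC_Vclass _
  have he0 : e = ∅ := (ZFSet.eq_empty e).2 fun y hy => he y (htr e heS y hy) hy
  subst he0
  have hmd : m = {∅, d} := by
    rcases (hA m).1 (ZFSet.mem_sep.1 hm).1 with rfl | ⟨x, hx, rfl⟩
    · rfl
    · exfalso
      simp only [c, ZFSet.mem_pair] at hem
      rcases hem with hem | hem
      · exact ZFSet.notMem_empty x (hem ▸ ZFSet.mem_singleton.2 rfl)
      · exact ZFSet.notMem_empty ∅ (by
          have h0 : (∅ : ZFSet.{u}) ∈ ({∅, {∅}, f x} : ZFSet.{u}) := by simp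
          rwa [← hem] at h0)
  refine ⟨κ', hκ', fun x hx => ?_⟩
  have hdm : d ∈ m := by simp [hmd]
  obtain ⟨p, hpS, hp, hpne, s, hsS, hsp, hxs, hst⟩ := hall d (htr m hmS d hdm) hdm x
    (htr d (htr m hmS d hdm) x hx) hx
  have hp' := ZFSet.mem_sep.1 hp
  have hsing : s = {x} := by
    apply ZFSet.ext
    intro t
    rw [ZFSet.mem_singleton]
    exact ⟨fun ht => hst t (htr s hsS t ht) ht, fun ht => ht ▸ hxs⟩
  have hpx : p = c x := by
    rcases (hA p).1 hp'.1 with rfl | ⟨x', hx', rfl⟩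
    · exfalso
      obtain ⟨z, -, hz⟩ := hpne ∅ heS (by simp)
      exact ZFSet.notMem_empty z hz
    · simp only [c, ZFSet.mem_pair] at hsp
      rcases hsp with hsp | hsp
      · rw [hsing, ZFSet.singleton_inj] at hsp
        rw [hsp]
      · exfalso
        have h1 : (∅ : ZFSet.{u}) = x := by
          rw [← ZFSet.mem_singleton, ← hsing, hsp]; simp
        have h2 : ({∅} : ZFSet.{u}) = x := by
          rw [← ZFSet.mem_singleton, ← hsing, hsp]; simp
        rw [← h1] at h2
        have h0 : (∅ : ZFSet.{u}) ∈ ({∅} : ZFSet.{u}) := by simp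
        rw [h2] at h0
        exact ZFSet.notMem_empty ∅ h0
  subst hpx
  have hr : ZFSet.rank (f x) < ZFSet.rank κ' := by
    refine lt_trans ?_ hp'.2
    refine (ZFSet.rank_lt_of_mem (y := f x) (x := {∅, {∅}, f x}) (by simp)).trans
      (ZFSet.rank_lt_of_mem (by simp [c]))
  exact ((hoo.mem (hf x hx)).rank_lt_iff_mem (hoo.mem hκ')).1 hr

/-! ### Inaccessibility -/

theorem mk_toSet (x : ZFSet.{u}) : #x.toSet = Cardinal.lift.{u + 1, u} x.card :=
  ZFSet.cardinalMk_coe_sort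

theorem shrewd_card_lt {κ : ZFSet.{u}} (h : Shrewd κ) {x : ZFSet.{u}}
    (hx : ZFSet.rank x < ZFSet.rank κ) : #x.toSet < #κ.toSet := by
  by_contra hlt
  obtain ⟨⟨e, he⟩⟩ := not_lt.1 hlt
  have hne : Nonempty κ.toSet :=
    ⟨⟨_, (zord_mem_iff h.1.1 (a := 0)).2 (by simpa using (shrewd_limit h).bot_lt)⟩⟩
  obtain ⟨κ', hκ', hb⟩ := shrewd_repl h hx
    (fun y => (Function.invFun (fun a : κ.toSet => (e a).1) y).1) (fun y _ => Subtype.property _)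
  have hinj : Function.Injective (fun a : κ.toSet => (e a).1) :=
    fun a b hab => he (Subtype.ext hab)
  have h1 := hb (e ⟨κ', hκ'⟩).1 (e ⟨κ', hκ'⟩).2
  have h2 := Function.leftInverse_invFun hinj ⟨κ', hκ'⟩
  rw [h2] at h1
  exact ZFSet.mem_irrefl _ h1

theorem zcard_exists {κ : ZFSet.{u}} (h : ZCard κ) {x : ZFSet.{u}} (hx : #x.toSet < #κ.toSet) :
    ∃ o ∈ κ, #o.toSet = #x.toSet := by
  refine ⟨x.card.ord.toZFSet, ?_, ?_⟩
  · rw [zord_mem_iff h.1]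
    by_contra hle
    have hle := Ordinal.card_le_card (not_lt.1 hle)
    rw [Cardinal.card_ord] at hle
    have hκ : κ.card = (ZFSet.rank κ).card := by
      rw [← Ordinal.card_toZFSet, (zord_iff.1 h.1).toZFSet_rank_eq]
    rw [← hκ] at hle
    rw [mk_toSet, mk_toSet, Cardinal.lift_lt] at hx
    exact absurd (hx.trans_le hle) (lt_irrefl _)
  · rw [mk_toSet, mk_toSet, Ordinal.card_toZFSet, Cardinal.card_ord]

theorem mk_powerset_toSet (x : ZFSet.{u}) :
    #(ZFSet.powerset x).toSet = (2 : Cardinal.{u+1}) ^ #x.toSet := by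
  rw [mk_toSet, mk_toSet, ZFSet.card_powerset]
  simp

theorem shrewd_goodH {κ : ZFSet.{u}} (h : Shrewd κ) : GoodH (ZFSet.rank κ) := by
  refine ⟨shrewd_limit h, shrewd_omega h, fun x hx => ?_⟩
  obtain ⟨o, ho, hc⟩ := zcard_exists h.1 (x := ZFSet.powerset x) (shrewd_card_lt h (by
    rw [ZFSet.rank_powerset]; exact (shrewd_limit h).succ_lt hx))
  refine ⟨o, ZFSet.rank_lt_of_mem ho, zord_iff.2 ((zord_iff.1 h.1.1).mem ho), ?_⟩
  rw [hc, mk_powerset_toSet]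
  exact Cardinal.cantor _

theorem omega_eq : ZFSet.omega.{u} = Ordinal.omega0.toZFSet := by
  have hnat : ∀ n : ℕ, ZFSet.mk (PSet.ofNat.{u} n) = (n : Ordinal.{u}).toZFSet := by
    intro n
    induction n with
    | zero => simp [PSet.ofNat]; rfl
    | succ n ih =>
      rw [Nat.cast_succ, Ordinal.toZFSet_add_one, ← ih]
      rfl
  apply ZFSet.ext
  intro z
  rw [Ordinal.mem_toZFSet_iff]
  constructor
  · intro hz
    induction z using Quotient.inductionOn with
    | h z =>
      obtain ⟨⟨n⟩, hn⟩ : z ∈ PSet.omega := hz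
      refine ⟨n, Ordinal.natCast_lt_omega0 n, ?_⟩
      rw [← hnat]
      exact (Quotient.sound hn).symm
  · rintro ⟨a, ha, rfl⟩
    obtain ⟨n, rfl⟩ := Ordinal.lt_omega0.1 ha
    rw [← hnat]
    exact ⟨⟨n⟩, PSet.Equiv.rfl⟩

theorem shrewd_inacc {κ : ZFSet.{u}} (h : Shrewd κ) :
    ZRegular κ ∧ ZFSet.omega ∈ κ ∧
        (∀ β ∈ κ, (2 : Cardinal.{u + 1}) ^ #β.toSet < #κ.toSet) := by
  have hoo := zord_iff.1 h.1.1
  have hw : ZFSet.omega ∈ κ := by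
    rw [omega_eq, zord_mem_iff h.1.1]
    exact shrewd_omega h
  refine ⟨⟨⟨h.1, hoo.subset_of_mem hw⟩, ?_⟩, hw, ?_⟩
  · intro x hx hcof
    have hle : #x.toSet ≤ #κ.toSet := mk_le_mk_of_subset (fun y hy => hx hy)
    by_contra hne
    obtain ⟨o, ho, hc⟩ := zcard_exists h.1 (lt_of_le_of_ne hle hne)
    obtain ⟨e⟩ := Cardinal.eq.1 hc
    classical
    have hz : (∅ : ZFSet.{u}) ∈ κ := by
      have := (zord_mem_iff h.1.1 (a := 0)).2 (by simpa using (shrewd_limit h).bot_lt)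
      simpa using this
    obtain ⟨κ', hκ', hb⟩ := shrewd_repl h (ZFSet.rank_lt_of_mem ho)
      (fun y => if hy : y ∈ o then (e ⟨y, hy⟩).1 else ∅) (fun y hy => by
        simp only [hy, dif_pos]
        exact hx (e ⟨y, hy⟩).2)
    obtain ⟨γ, hγ, hκγ⟩ := hcof κ' hκ'
    have h1 := hb (e.symm ⟨γ, hγ⟩).1 (e.symm ⟨γ, hγ⟩).2
    have h2 : (e.symm ⟨γ, hγ⟩).1 ∈ o := (e.symm ⟨γ, hγ⟩).2
    rw [dif_pos h2] at h1
    have h3 : (e ⟨(e.symm ⟨γ, hγ⟩).1, h2⟩).1 = γ := by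
      have := e.apply_symm_apply ⟨γ, hγ⟩
      exact congrArg Subtype.val this
    rw [h3] at h1
    rcases hκγ with h4 | rfl
    · exact ZFSet.mem_asymm h1 h4
    · exact ZFSet.mem_irrefl _ h1
  · intro β hβ
    rw [← mk_powerset_toSet]
    apply shrewd_card_lt h
    rw [ZFSet.rank_powerset]
    exact (shrewd_limit h).succ_lt (ZFSet.rank_lt_of_mem hβ)

theorem shrewd_add {κ : ZFSet.{u}} (h : Shrewd κ) {a b : Ordinal.{u}} (ha : a < ZFSet.rank κ)
    (hb : b < ZFSet.rank κ) : a + b < ZFSet.rank κ := by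
  have hκ : κ.card = (ZFSet.rank κ).card := by
    rw [← Ordinal.card_toZFSet, (zord_iff.1 h.1.1).toZFSet_rank_eq]
  have hord : (ZFSet.rank κ).card.ord = ZFSet.rank κ := by
    refine le_antisymm (Cardinal.ord_card_le _) (le_of_forall_lt fun a ha => ?_)
    rw [Cardinal.lt_ord]
    have := h.1.2 _ ((zord_mem_iff h.1.1).2 ha)
    rwa [mk_toSet, mk_toSet, Cardinal.lift_lt, Ordinal.card_toZFSet, hκ] at this
  have hp := Ordinal.isPrincipal_add_ord (c := (ZFSet.rank κ).card) (by
    rw [Ordinal.aleph0_le_card]; exact (shrewd_omega h).le)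
  rw [hord] at hp
  exact hp ha hb

theorem exists_goodH (r : Ordinal.{u}) : ∃ l, r < l ∧ GoodH l := by
  let g : Ordinal.{u} → Ordinal.{u} := fun a =>
    Order.succ (max a (Order.succ (ZFSet.vonNeumann a).card).ord)
  let s : ℕ → Ordinal.{u} := fun n => g^[n] (max r Ordinal.omega0)
  have hs : ∀ n, s (n + 1) = g (s n) := fun n => Function.iterate_succ_apply' _ _ _
  have hlt : ∀ n, s n < ⨆ n, s n := by
    intro n
    refine lt_of_lt_of_le ?_ (Ordinal.le_iSup s (n + 1))
    rw [hs]
    exact Order.lt_succ_of_le (le_max_left _ _)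
  refine ⟨⨆ n, s n, (le_max_left _ _).trans_lt (hlt 0), ?_, (le_max_right _ _).trans_lt (hlt 0), ?_⟩
  · refine Ordinal.isSuccLimit_iff.2 ⟨(zero_le.trans_lt (hlt 0)).ne',
      Order.isSuccPrelimit_of_succ_lt ?_⟩
    intro a ha
    obtain ⟨n, hn⟩ := Ordinal.lt_iSup_iff.1 ha
    exact (Order.succ_le_of_lt hn).trans_lt (hlt n)
  · intro x hx
    obtain ⟨n, hn⟩ := Ordinal.lt_iSup_iff.1 hx
    refine ⟨(Order.succ (ZFSet.vonNeumann (s n)).card).ord.toZFSet, ?_,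
      zord_iff.2 (ZFSet.isOrdinal_toZFSet _), ?_⟩
    · show ZFSet.rank _ < _
      rw [Ordinal.rank_toZFSet]
      refine lt_of_lt_of_le ?_ (Ordinal.le_iSup s (n + 1))
      rw [hs]
      exact Order.lt_succ_of_le (le_max_right _ _)
    · rw [mk_toSet, mk_toSet, Cardinal.lift_lt, Ordinal.card_toZFSet, Cardinal.card_ord,
        Order.lt_succ_iff]
      exact ZFSet.card_mono (ZFSet.subset_vonNeumann.2 hn.le)

/-! ### Coding formulas -/

/-- Relativised definition of the ordered pair. -/
def PairS (S : Set ZFSet.{u}) (c x y : ZFSet.{u}) : Prop :=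
  ∀ a ∈ S, a ∈ c ↔ ((∀ b ∈ S, b ∈ a ↔ b = x) ∨ (∀ b ∈ S, b ∈ a ↔ b = x ∨ b = y))

/-- The formula expressing that a set is an ordered pair. -/
def fPair (c x y : ℕ) : SF := .all 4 (.iff (.mem 4 c) (.or (.all 5 (.iff (.mem 5 4) (.eq 5 x)))
  (.all 5 (.iff (.mem 5 4) (.or (.eq 5 x) (.eq 5 y))))))

theorem sat_fPair (S : Set ZFSet.{u}) (v : ℕ → ZFSet.{u}) (c x y : ℕ) (hc : c ≠ 4)
    (hx4 : x ≠ 4) (hx5 : x ≠ 5) (hy4 : y ≠ 4) (hy5 : y ≠ 5) :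
    SatIn ∅ S (fPair c x y) v ↔ PairS S (v c) (v x) (v y) := by
  simp only [fPair, PairS, sat_all, sat_iff, sat_or, sat_mem, sat_eq]
  simp [hc, hx4, hx5, hy4, hy5]

theorem fv_fPair {c x y i : ℕ} (h : i ∈ (fPair c x y).fv) : i = c ∨ i = x ∨ i = y := by
  simp [fPair, SF.fv, SF.all, SF.iff, SF.imp, SF.or] at h
  grind

theorem pairS_iff {l : Ordinal.{u}} (hl : Order.IsSuccLimit l) {c x y : ZFSet.{u}}
    (hc : c ∈ Vclass l) (hx : x ∈ Vclass l) (hy : y ∈ Vclass l) :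
    PairS (Vclass l) c x y ↔ c = ZFSet.pair x y := by
  have htr : TransC (Vclass l) := transC_Vclass l
  have h1 : ({x} : ZFSet.{u}) ∈ Vclass l := by
    show ZFSet.rank _ < _
    rw [ZFSet.rank_singleton]; exact hl.succ_lt hx
  have h2 : ({x, y} : ZFSet.{u}) ∈ Vclass l := by
    show ZFSet.rank _ < _
    rw [ZFSet.rank_pair]; exact max_lt (hl.succ_lt hx) (hl.succ_lt hy)
  have e1 : ∀ a ∈ Vclass l, (∀ b ∈ Vclass l, b ∈ a ↔ b = x) ↔ a = {x} := by
    intro a ha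
    constructor
    · intro h
      apply ZFSet.ext
      intro b
      rw [ZFSet.mem_singleton]
      exact ⟨fun hb => (h b (htr a ha b hb)).1 hb, fun hb => (h b (hb ▸ hx)).2 hb⟩
    · rintro rfl b _; simp
  have e2 : ∀ a ∈ Vclass l, (∀ b ∈ Vclass l, b ∈ a ↔ b = x ∨ b = y) ↔ a = {x, y} := by
    intro a ha
    constructor
    · intro h
      apply ZFSet.ext
      intro b
      rw [ZFSet.mem_pair]
      refine ⟨fun hb => (h b (htr a ha b hb)).1 hb, fun hb => (h b ?_).2 hb⟩
      rcases hb with rfl | rfl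
      exacts [hx, hy]
    · rintro rfl b _; simp
  constructor
  · intro h
    apply ZFSet.ext
    intro a
    rw [ZFSet.pair, ZFSet.mem_pair]
    constructor
    · intro ha
      have haS := htr c hc a ha
      have := (h a haS).1 ha
      rwa [e1 a haS, e2 a haS] at this
    · intro ha
      have haS : a ∈ Vclass l := by
        rcases ha with rfl | rfl
        exacts [h1, h2]
      refine (h a haS).2 ?_
      rwa [e1 a haS, e2 a haS]
  · rintro rfl a ha
    rw [e1 a ha, e2 a ha, ZFSet.pair, ZFSet.mem_pair]

theorem pair_mem_Vclass {l : Ordinal.{u}} (hl : Order.IsSuccLimit l) {x y : ZFSet.{u}}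
    (hx : x ∈ Vclass l) (hy : y ∈ Vclass l) : ZFSet.pair x y ∈ Vclass l := by
  show ZFSet.rank _ < _
  have hx : ZFSet.rank x < l := hx
  have hy : ZFSet.rank y < l := hy
  rw [ZFSet.pair, ZFSet.rank_pair, ZFSet.rank_pair, ZFSet.rank_singleton]
  exact max_lt (hl.succ_lt (hl.succ_lt hx))
    (hl.succ_lt (max_lt (hl.succ_lt hx) (hl.succ_lt hy)))

/-- f codes an injection of `o` into `x`. -/
def InjS (S : Set ZFSet.{u}) (x o f : ZFSet.{u}) : Prop :=
  (∀ b ∈ S, b ∈ o → ∃ a ∈ S, a ∈ x ∧ ∃ p ∈ S, p ∈ f ∧ PairS S p a b) ∧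
  ∀ a ∈ S, ∀ b ∈ S, ∀ b' ∈ S, ∀ p ∈ S, ∀ p' ∈ S,
    (p ∈ f ∧ PairS S p a b) ∧ (p' ∈ f ∧ PairS S p' a b') → b = b'

theorem injS_iff {l : Ordinal.{u}} (hl : Order.IsSuccLimit l) {x o : ZFSet.{u}}
    (hx : x ∈ Vclass l) (ho : o ∈ Vclass l) :
    (∃ f ∈ Vclass l, InjS (Vclass l) x o f) ↔ #o.toSet ≤ #x.toSet := by
  have htr : TransC (Vclass l) := transC_Vclass l
  constructor
  · rintro ⟨f, hf, h1, h2⟩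
    have h1' : ∀ b : o.toSet, ∃ a : x.toSet, ZFSet.pair a.1 b.1 ∈ f := by
      rintro ⟨b, hb⟩
      obtain ⟨a, haS, ha, p, hpS, hp, hP⟩ := h1 b (htr o ho b hb) hb
      rw [pairS_iff hl hpS haS (htr o ho b hb)] at hP
      exact ⟨⟨a, ha⟩, hP ▸ hp⟩
    choose g hg using h1'
    refine ⟨⟨g, ?_⟩⟩
    intro b b' hbb
    have haS := htr x hx _ (g b).2
    have hbS := htr o ho _ b.2
    have hbS' := htr o ho _ b'.2
    apply Subtype.ext
    have hp := pair_mem_Vclass hl haS hbS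
    have hp' := pair_mem_Vclass hl haS hbS'
    refine h2 (g b).1 haS b.1 hbS b'.1 hbS' _ hp _ hp' ⟨⟨hg b, (pairS_iff hl hp haS hbS).2 rfl⟩,
      ⟨?_, (pairS_iff hl hp' haS hbS').2 rfl⟩⟩
    rw [hbb]
    exact hg b'
  · rintro ⟨⟨e, he⟩⟩
    let f : ZFSet.{u} := ZFSet.sep (fun p => ∃ b : o.toSet, p = ZFSet.pair (e b).1 b.1)
      (ZFSet.prod x o)
    have hf : f ∈ Vclass l := by
      show ZFSet.rank f < l
      have hm : max (ZFSet.rank x) (ZFSet.rank o) < l := max_lt hx ho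
      refine lt_of_le_of_lt (b := Order.succ (Order.succ (max (ZFSet.rank x) (ZFSet.rank o))))
        (ZFSet.rank_le_iff.2 ?_) (hl.succ_lt (hl.succ_lt hm))
      intro p hp
      obtain ⟨a, ha, b, hb, rfl⟩ := ZFSet.mem_prod.1 (ZFSet.mem_sep.1 hp).1
      have h1 := Order.succ_le_of_lt ((ZFSet.rank_lt_of_mem ha).trans_le (le_max_left _ (ZFSet.rank o)))
      have h2 := Order.succ_le_of_lt ((ZFSet.rank_lt_of_mem hb).trans_le (le_max_right (ZFSet.rank x) _))
      rw [ZFSet.pair, ZFSet.rank_pair, ZFSet.rank_pair, ZFSet.rank_singleton]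
      exact max_lt (Order.succ_lt_succ (Order.lt_succ_of_le h1)) (Order.succ_lt_succ (Order.lt_succ_of_le (max_le h1 h2)))
    refine ⟨f, hf, ?_, ?_⟩
    · intro b hbS hb
      have haS := htr x hx _ (e ⟨b, hb⟩).2
      have hp := pair_mem_Vclass hl haS hbS
      refine ⟨(e ⟨b, hb⟩).1, haS, (e ⟨b, hb⟩).2, _, hp, ?_, (pairS_iff hl hp haS hbS).2 rfl⟩
      refine ZFSet.mem_sep.2 ⟨ZFSet.mem_prod.2 ⟨_, (e ⟨b, hb⟩).2, b, hb, rfl⟩, ⟨b, hb⟩, rfl⟩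
    · rintro a haS b hbS b' hbS' p hpS p' hpS' ⟨⟨hp, hP⟩, hp', hP'⟩
      rw [pairS_iff hl hpS haS hbS] at hP
      rw [pairS_iff hl hpS' haS hbS'] at hP'
      obtain ⟨-, c, hc⟩ := ZFSet.mem_sep.1 hp
      obtain ⟨-, c', hc'⟩ := ZFSet.mem_sep.1 hp'
      rw [hP] at hc
      rw [hP'] at hc'
      obtain ⟨h1, h2⟩ := ZFSet.pair_injective hc
      obtain ⟨h3, h4⟩ := ZFSet.pair_injective hc'
      have : c = c' := he (Subtype.ext (h1.symm.trans h3))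
      rw [h2, h4, this]

/-- The formula expressing that `V_l` satisfies `GoodH`. -/
def fGood : SF :=
  .and (.all 6 (.ex 7 (.mem 6 7)))
  (.and (.ex 8 (.and (.ex 9 (.mem 9 8))
      (.all 9 (.imp (.mem 9 8) (.ex 10 (.and (.mem 10 8) (.mem 9 10)))))))
  (.all 6 (.ex 7 (.and
    (.all 8 (.imp (.mem 8 7) (.all 9 (.imp (.mem 9 8)
      (.and (.mem 9 7) (.all 10 (.imp (.mem 10 9) (.mem 10 8))))))))
    (.not (.ex 8 (.and
      (.all 9 (.imp (.mem 9 7) (.ex 10 (.and (.mem 10 6) (.ex 11 (.and (.mem 11 8)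
        (fPair 11 10 9)))))))
      (.all 9 (.all 10 (.all 11 (.all 12 (.all 13 (.imp
        (.and (.and (.mem 12 8) (fPair 12 9 10)) (.and (.mem 13 8) (fPair 13 9 11)))
        (.eq 10 11))))))))))))))

theorem fv_fGood : fGood.fv = ∅ := by
  refine Set.eq_empty_of_forall_notMem fun i hi => ?_
  simp only [fGood, fPair, SF.fv, SF.all, SF.iff, SF.imp, SF.or, Set.mem_sdiff, Set.mem_union,
    Set.mem_insert_iff, Set.mem_singleton_iff] at hi
  omega

theorem sat_fGood {l : Ordinal.{u}} (h0 : 0 < l) (v : ℕ → ZFSet.{u}) :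
    SatIn ∅ (Vclass l) fGood v ↔ GoodH l := by
  have htr : TransC (Vclass l) := transC_Vclass l
  have key : SatIn ∅ (Vclass l) fGood v ↔
      (∀ x ∈ Vclass l, ∃ y ∈ Vclass l, x ∈ y) ∧
      (∃ w ∈ Vclass l, (∃ x ∈ Vclass l, x ∈ w) ∧ ∀ x ∈ Vclass l, x ∈ w →
        ∃ y ∈ Vclass l, y ∈ w ∧ x ∈ y) ∧
      (∀ x ∈ Vclass l, ∃ o ∈ Vclass l,
        (∀ y ∈ Vclass l, y ∈ o → ∀ z ∈ Vclass l, z ∈ y → z ∈ o ∧ ∀ t ∈ Vclass l, t ∈ z → t ∈ y) ∧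
        ¬ ∃ f ∈ Vclass l, InjS (Vclass l) x o f) := by
    simp (disch := decide) only [fGood, InjS, sat_all, sat_ex, sat_and, sat_imp, sat_mem, sat_eq,
      sat_not, sat_fPair]
    simp only [Function.update_apply]
    simp
  rw [key, GoodH]
  have hlim : (∀ x ∈ Vclass l, ∃ y ∈ Vclass l, x ∈ y) ↔ Order.IsSuccLimit l := by
    constructor
    · intro h
      refine Ordinal.isSuccLimit_iff.2 ⟨h0.ne', Order.isSuccPrelimit_of_succ_lt ?_⟩
      intro a ha
      obtain ⟨y, hy, hxy⟩ := h a.toZFSet (by simpa [Vclass] using ha)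
      have := ZFSet.rank_lt_of_mem hxy
      rw [Ordinal.rank_toZFSet] at this
      exact (Order.succ_le_of_lt this).trans_lt hy
    · intro hl x hx
      exact ⟨{x}, by
        show ZFSet.rank _ < _
        rw [ZFSet.rank_singleton]; exact hl.succ_lt hx, by simp⟩
  rw [hlim]
  refine and_congr_right fun hl => and_congr ?_ (forall₂_congr fun x hx => ?_)
  · constructor
    · rintro ⟨w, hw, ⟨x, -, hx⟩, h⟩
      have := zord_rank_limit (κ := w) ⟨x, hx⟩ (fun x hx => by
        obtain ⟨y, -, hy⟩ := h x (htr w hw x hx) hx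
        exact ⟨y, hy⟩)
      exact (Ordinal.omega0_le_of_isSuccLimit this).trans_lt hw
    · intro hw
      have hwS : Ordinal.omega0.toZFSet ∈ Vclass l := by simpa [Vclass] using hw
      refine ⟨Ordinal.omega0.toZFSet, hwS, ⟨(0 : Ordinal).toZFSet, ?_, ?_⟩, ?_⟩
      · simpa [Vclass] using h0
      · exact Ordinal.mem_toZFSet_iff.2 ⟨0, Ordinal.omega0_pos, rfl⟩
      · intro x _ hx
        obtain ⟨a, ha, rfl⟩ := Ordinal.mem_toZFSet_iff.1 hx
        have hm : (Order.succ a).toZFSet ∈ Ordinal.omega0.toZFSet :=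
          Ordinal.mem_toZFSet_iff.2 ⟨_, Ordinal.isSuccLimit_omega0.succ_lt ha, rfl⟩
        exact ⟨_, htr _ hwS _ hm, hm, Ordinal.mem_toZFSet_iff.2 ⟨_, Order.lt_succ a, rfl⟩⟩
  · refine exists_congr fun o => and_congr_right fun ho => ?_
    rw [injS_iff hl hx ho, not_le]
    refine and_congr_left fun _ => ?_
    constructor
    · intro h
      refine ⟨fun y hy z hz => ?_, fun y hy z hz t ht => ?_⟩
      · have hyS := htr o ho y hy
        exact (h y hyS hy z (htr y hyS z hz) hz).1
      · have hyS := htr o ho y hy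
        have hzS := htr y hyS z hz
        exact (h y hyS hy z hzS hz).2 t (htr z hzS t ht) ht
    · rintro ⟨h1, h2⟩ y _ hy z _ hz
      exact ⟨h1 y hy hz, fun t _ ht => h2 y hy z hz ht⟩

/-- Coding a list of sets by a set. -/
noncomputable def enc : List ZFSet.{u} → ZFSet.{u}
  | [] => ∅
  | p :: ps => ZFSet.pair p (enc ps)

/-- Decoding a list of variables from the set assigned to variable `2`. -/
def dec : List ℕ → SF → SF
  | [], φ => φ
  | k :: ks, φ => .ex k (.ex 3 (.and (fPair 2 k 3) (.ex 2 (.and (.eq 2 3) (dec ks φ)))))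

theorem fv_dec (φ : SF) (ks : List ℕ) (i : ℕ) (hi : i ∈ (dec ks φ).fv) :
    i = 2 ∨ (i ∈ φ.fv ∧ i ∉ ks) := by
  induction ks generalizing i with
  | nil => exact Or.inr ⟨hi, by simp⟩
  | cons k ks ih =>
    obtain ⟨⟨hi | ⟨(hi | hi) | hi, h2⟩, h3⟩, hk⟩ := hi
    · rcases fv_fPair hi with h | h | h
      · exact Or.inl h
      · exact absurd h hk
      · exact absurd h h3
    · exact absurd hi h2
    · exact absurd hi h3
    · rcases ih i hi with h | ⟨h, h'⟩
      · exact absurd h h2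
      · refine Or.inr ⟨h, ?_⟩
        simp only [List.mem_cons, not_or]
        exact ⟨hk, h'⟩

theorem enc_mem {l : Ordinal.{u}} (hl : Order.IsSuccLimit l) (ps : List ZFSet.{u})
    (h : ∀ p ∈ ps, p ∈ Vclass l) : enc ps ∈ Vclass l := by
  induction ps with
  | nil =>
    show ZFSet.rank ∅ < l
    simpa using hl.bot_lt
  | cons p ps ih =>
    exact pair_mem_Vclass hl (h p (by simp)) (ih fun q hq => h q (by simp [hq]))

theorem rank_lt_pair (x y : ZFSet.{u}) : ZFSet.rank x < ZFSet.rank (ZFSet.pair x y) ∧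
    ZFSet.rank y < ZFSet.rank (ZFSet.pair x y) := by
  have h : ZFSet.rank {x, y} < ZFSet.rank (ZFSet.pair x y) :=
    ZFSet.rank_lt_of_mem (by simp [ZFSet.pair])
  exact ⟨(ZFSet.rank_lt_of_mem (by simp)).trans h, (ZFSet.rank_lt_of_mem (by simp)).trans h⟩

theorem rank_lt_enc (ps : List ZFSet.{u}) (p : ZFSet.{u}) (h : p ∈ ps) :
    ZFSet.rank p < ZFSet.rank (enc ps) := by
  induction ps with
  | nil => simp at h
  | cons q ps ih =>
    rcases List.mem_cons.1 h with rfl | h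
    · exact (rank_lt_pair _ _).1
    · exact (ih h).trans (rank_lt_pair _ _).2

theorem sat_dec {l : Ordinal.{u}} (hl : Order.IsSuccLimit l) (φ : SF) (hφ : ∀ i ∈ φ.fv, 6 ≤ i)
    (u : ℕ → ZFSet.{u}) (ks : List ℕ) (hks : ∀ k ∈ ks, 6 ≤ k) (hu : ∀ k ∈ ks, u k ∈ Vclass l)
    (v : ℕ → ZFSet.{u}) (hv : v 2 = enc (ks.map u)) :
    SatIn ∅ (Vclass l) (dec ks φ) v ↔
      SatIn ∅ (Vclass l) φ (fun i => if i ∈ ks then u i else v i) := by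
  induction ks generalizing v with
  | nil => simp [dec]
  | cons k ks ih =>
    have hk := hks k (by simp)
    have hkS := hu k (by simp)
    have hks' : ∀ k ∈ ks, 6 ≤ k := fun j hj => hks j (by simp [hj])
    have hu' : ∀ k ∈ ks, u k ∈ Vclass l := fun j hj => hu j (by simp [hj])
    have heS : enc (ks.map u) ∈ Vclass l := enc_mem hl _ (by simpa using hu')
    have hpS := pair_mem_Vclass hl hkS heS
    have e1 : SatIn ∅ (Vclass l) (dec (k :: ks) φ) v ↔
        ∃ x ∈ Vclass l, ∃ y ∈ Vclass l, PairS (Vclass l) (v 2) x y ∧ ∃ z ∈ Vclass l, z = y ∧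
          SatIn ∅ (Vclass l) (dec ks φ)
            (Function.update (Function.update (Function.update v k x) 3 y) 2 z) := by
      simp only [dec, sat_ex, sat_and, sat_eq]
      refine exists_congr fun x => and_congr_right fun _ => exists_congr fun y =>
        and_congr_right fun _ => and_congr ?_ ?_
      · rw [sat_fPair _ _ _ _ _ (by decide) (by omega) (by omega) (by decide) (by decide)]
        have a1 : (2 : ℕ) ≠ k := by omega
        have a2 : k ≠ 3 := by omega
        simp [a1, a2]
      · simp
    have e2 : SatIn ∅ (Vclass l) (dec (k :: ks) φ) v ↔ SatIn ∅ (Vclass l) (dec ks φ)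
            (Function.update (Function.update (Function.update v k (u k)) 3 (enc (ks.map u))) 2
              (enc (ks.map u))) := by
      rw [e1]
      have hv' : v 2 = ZFSet.pair (u k) (enc (ks.map u)) := hv
      rw [hv']
      constructor
      · rintro ⟨x, hx, y, hy, hP, z, hz, rfl, hs⟩
        rw [pairS_iff hl hpS hx hy] at hP
        obtain ⟨h1, h2⟩ := ZFSet.pair_injective hP
        rw [h1, h2]
        exact hs
      · intro hs
        exact ⟨u k, hkS, _, heS, (pairS_iff hl hpS hkS heS).2 rfl, _, heS, rfl, hs⟩
    rw [e2, ih hks' hu' _ (by simp)]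
    refine ⟨fun hs => (sat_congr _ _ _ _ _ _ ?_).1 hs, fun hs => (sat_congr _ _ _ _ _ _ ?_).2 hs⟩ <;>
    · intro i hi
      have h6 := hφ i hi
      have a1 : i ≠ 2 := by omega
      have a2 : i ≠ 3 := by omega
      by_cases hik : i = k
      · subst hik; simp [a1, a2]
      · simp [a1, a2, hik]

/-- Shifting all variables by `6`. -/
def SF.shift : SF → SF
  | .mem i j => .mem (i + 6) (j + 6)
  | .eq i j => .eq (i + 6) (j + 6)
  | .pred i => .pred (i + 6)
  | .not φ => .not φ.shift
  | .and φ ψ => .and φ.shift ψ.shift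
  | .ex k φ => .ex (k + 6) φ.shift

theorem sat_shift (P S : Set ZFSet.{u}) (φ : SF) (v : ℕ → ZFSet.{u}) :
    SatIn P S φ.shift v ↔ SatIn P S φ (fun i => v (i + 6)) := by
  induction φ generalizing v with
  | mem i j => exact Iff.rfl
  | eq i j => exact Iff.rfl
  | pred i => exact Iff.rfl
  | not φ ih => exact not_congr (ih v)
  | and φ ψ ih1 ih2 => exact and_congr (ih1 v) (ih2 v)
  | ex k φ ih =>
    refine exists_congr fun x => and_congr_right fun _ => (ih _).trans ?_
    have : (fun i => Function.update v (k + 6) x (i + 6)) =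
        Function.update (fun i => v (i + 6)) k x := by
      funext i
      simp [Function.update_apply]
    rw [this]
    exact Iff.rfl

theorem fv_shift (φ : SF) (i : ℕ) (hi : i ∈ φ.shift.fv) : ∃ j ∈ φ.fv, i = j + 6 := by
  induction φ generalizing i with
  | mem a b =>
    rcases hi with rfl | rfl
    exacts [⟨a, Or.inl rfl, rfl⟩, ⟨b, Or.inr rfl, rfl⟩]
  | eq a b =>
    rcases hi with rfl | rfl
    exacts [⟨a, Or.inl rfl, rfl⟩, ⟨b, Or.inr rfl, rfl⟩]
  | pred a => exact ⟨a, rfl, hi⟩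
  | not φ ih => exact ih i hi
  | and φ ψ ih1 ih2 =>
    rcases hi with hi | hi
    · obtain ⟨j, hj, rfl⟩ := ih1 i hi
      exact ⟨j, Or.inl hj, rfl⟩
    · obtain ⟨j, hj, rfl⟩ := ih2 i hi
      exact ⟨j, Or.inr hj, rfl⟩
  | ex k φ ih =>
    obtain ⟨j, hj, rfl⟩ := ih i hi.1
    refine ⟨j, ⟨hj, ?_⟩, rfl⟩
    rintro rfl
    exact hi.2 rfl

/-! ### Σ₂-reflection -/

theorem shrewd_sigma2 {κ : ZFSet.{u}} (h : Shrewd κ) {φ : SF} (hφ : IsSigma 2 φ)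
    (v : ℕ → ZFSet.{u}) (hv : ∀ i, v i ∈ Vclass (ZFSet.rank κ)) (hs : SatIn ∅ Set.univ φ v) :
    SatIn ∅ (Vclass (ZFSet.rank κ)) φ v := by
  obtain ⟨r, hr⟩ := sigma2_down hφ v hs
  obtain ⟨l, hrl, hl⟩ := exists_goodH (max r (ZFSet.rank κ))
  have hκl : ZFSet.rank κ ≤ l := (le_max_right _ _).trans hrl.le
  have hsl := hr l ((le_max_left _ _).trans hrl.le) (fun i => (hv i).trans_le hκl)
  obtain ⟨n, hn⟩ := fv_bdd φ
  have hlim := shrewd_limit h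
  let ks : List ℕ := (List.range n).map (· + 6)
  let u : ℕ → ZFSet.{u} := fun i => v (i - 6)
  let p := enc (ks.map u)
  have hks : ∀ k ∈ ks, 6 ≤ k := by simp [ks]
  have hmem : ∀ j, j + 6 ∈ ks ↔ j < n := by simp [ks]
  have hp : p ∈ Vclass (ZFSet.rank κ) := enc_mem hlim _ (by
    intro q hq
    obtain ⟨k, -, rfl⟩ := List.mem_map.1 hq
    exact hv _)
  have hfv6 : ∀ i ∈ φ.shift.fv, 6 ≤ i := by
    intro i hi
    obtain ⟨j, -, rfl⟩ := fv_shift φ i hi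
    omega
  have hdec : ∀ l' : Ordinal.{u}, Order.IsSuccLimit l' → (∀ k ∈ ks, u k ∈ Vclass l') →
      ∀ w : ℕ → ZFSet.{u}, w 2 = p → (SatIn ∅ (Vclass l') (dec ks φ.shift) w ↔
        SatIn ∅ (Vclass l') φ (fun i => if i < n then v i else ∅)) := by
    intro l' hl' hu w hw
    rw [sat_dec hl' φ.shift hfv6 u ks hks hu w hw, sat_shift]
    have he : ∀ i ∈ φ.fv, (fun i => if i + 6 ∈ ks then u (i + 6) else w (i + 6)) i =
        (fun i => if i < n then v i else ∅) i := by
      intro i hi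
      have := hn i hi
      simp [hmem, this, u]
    exact sat_congr _ _ _ _ _ _ he
  have hv0 : ∀ S : Set ZFSet.{u}, SatIn ∅ S φ v ↔
      SatIn ∅ S φ (fun i => if i < n then v i else ∅) := fun S =>
    sat_congr _ _ _ _ _ _ (fun i hi => by simp [hn i hi])
  obtain ⟨κ', hκ', α', hα', hpr, hw⟩ := shrewd_param h (φ := .and fGood (dec ks φ.shift))
    (α := (l - ZFSet.rank κ).toZFSet) (p := p) (v := fun i => if i = 1 then κ else p) (by
      rintro i (hi | hi)
      · rw [fv_fGood] at hi; exact hi.elim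
      · rcases fv_dec _ _ _ hi with h | ⟨h1, h2⟩
        · exact Or.inr h
        · exfalso
          obtain ⟨j, hj, rfl⟩ := fv_shift φ i h1
          exact h2 ((hmem j).2 (hn j hj)))
    (zord_iff.2 (ZFSet.isOrdinal_toZFSet _)) hp (by simp) (by simp) (by
      rw [Ordinal.rank_toZFSet, Ordinal.add_sub_cancel_of_le hκl]
      refine ⟨(sat_fGood (by simpa using hl.1.bot_lt) _).2 hl, ?_⟩
      refine (hdec l hl.1 (fun k _ => (hv _).trans_le hκl) _ (by simp)).2 ?_
      exact (hv0 _).1 hsl)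
  have hs' := hw (fun i => if i = 1 then κ' else p) (by simp) (by simp)
  set l' := ZFSet.rank κ' + ZFSet.rank α' with hl'
  have hpl : ZFSet.rank p < l' := hpr.trans_le le_self_add
  have hl'κ : l' < ZFSet.rank κ :=
    shrewd_add h (ZFSet.rank_lt_of_mem hκ') (ZFSet.rank_lt_of_mem hα')
  have hgood : GoodH l' := (sat_fGood (zero_le.trans_lt hpl) _).1 hs'.1
  have huS : ∀ k ∈ ks, u k ∈ Vclass l' := fun k hk =>
    (rank_lt_enc _ _ (List.mem_map.2 ⟨k, hk, rfl⟩)).trans hpl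
  have hφ' := (hdec l' hgood.1 huS _ (by simp)).1 hs'.2
  have hv0S : ∀ i, (fun i => if i < n then v i else ∅) i ∈ Vclass l' := by
    intro i
    by_cases hi : i < n
    · have := huS (i + 6) ((hmem i).2 hi)
      simpa [hi, u] using this
    · simp only [hi, if_false]
      show ZFSet.rank ∅ < l'
      simpa using zero_le.trans_lt hpl
  rw [hv0]
  refine sigma2_up (fun x hx => lt_trans hx hl'κ) ?_ hφ _ hv0S hφ'
  intro σ hσ w hw hsw
  exact sigma1_correct hgood hσ w hw (sigma1_up (Set.subset_univ _) (transC_Vclass _) hσ w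
    (fun i => lt_trans (hw i) hl'κ) hsw)

/-- Every shrewd cardinal is Σ₂-reflecting: if `κ` is shrewd, then `κ` is
(strongly) inaccessible and `V_κ` is a Σ₂-elementary submodel of `V`. -/
theorem shrewd_sigma2Reflecting (κ : ZFSet.{u}) (h : Shrewd κ) :
    (ZRegular κ ∧ ZFSet.omega ∈ κ ∧
        (∀ β ∈ κ, (2 : Cardinal.{u + 1}) ^ #β.toSet < #κ.toSet)) ∧
      SigmaElemSub ∅ 2 (Vclass (ZFSet.rank κ)) Set.univ := by
  refine ⟨shrewd_inacc h, Set.subset_univ _, fun φ hφ v hv => ⟨fun hs => ?_, fun hs => ?_⟩⟩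
  · exact sigma2_up (Set.subset_univ _)
      (fun σ hσ w hw hsw => sigma1_correct (shrewd_goodH h) hσ w hw hsw) hφ v hv hs
  · exact shrewd_sigma2 h hφ v hv hs
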